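/- Let Φ = Σ_{k=1}^∞ λ_k u_k ∧ v_k be a canonical form of a normalized Φ ∈ h∧h, let B = Σ_{k=1}^∞ λ_k c_{k,↓} c_{k,↑}, and let Ψ_M = (B*)^M Ω. Then for every M ∈ ℕ: ⟨Ψ_M, B*B Ψ_M⟩ = M·‖Ψ_M‖² − ((M−1)/2)·Σ_{k=1}^∞ λ_k²·(‖c_{k,↑}Ψ_M‖² + ‖c_{k,↓}Ψ_M‖²). -/

import Mathlib

/- Setting: `H` is the one-particle Hilbert space `h`, `F` is the fermionic Fock space over
`h` (carrying annihilation operators `an f = c(f)` satisfying the CAR, with adjoints the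
creation operators `c*(f)`, and vacuum `Ω`), and `T` is the two-particle space `h ⊗ h`
(realized by a bilinear map `tp`, with the antisymmetric tensors `h ∧ h` inside it). -/

open scoped ComplexOrder

notation "⟪" x ", " y "⟫_ℂ" => @inner ℂ _ _ x y
open ContinuousLinearMap

noncomputable section

/-- A family of annihilation operators `an f = c(f)` on a Fock space `F` satisfying the
canonical anticommutation relations `{c(f), c(g)} = 0` and `{c(f), c*(g)} = ⟪f, g⟫ • 1`. -/
def SatisfiesCAR {H F : Type*} [NormedAddCommGroup H] [InnerProductSpace ℂ H]
    [NormedAddCommGroup F] [InnerProductSpace ℂ F] [CompleteSpace F]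
    (an : H → F →L[ℂ] F) : Prop :=
  (∀ f g : H, an f ∘L an g + an g ∘L an f = 0) ∧
  (∀ f g : H, an f ∘L adjoint (an g) + adjoint (an g) ∘L an f = ⟪f, g⟫_ℂ • (1 : F →L[ℂ] F))

/-- The action of `B = ∑ₖ λₖ c_{k,↓} c_{k,↑}` (where `c_{k,↑} = an (u k)` and
`c_{k,↓} = an (v k)`) on a vector of the Fock space. -/
def applyB {H F : Type*} [NormedAddCommGroup F] [InnerProductSpace ℂ F]
    (an : H → F →L[ℂ] F) (u v : ℕ → H) (lam : ℕ → ℝ) (ψ : F) : F :=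
  ∑' k : ℕ, (lam k : ℂ) • an (v k) (an (u k) ψ)

/-- The action of `B* = ∑ₖ λₖ c*_{k,↑} c*_{k,↓}` on a vector of the Fock space. -/
def applyBd {H F : Type*} [NormedAddCommGroup F] [InnerProductSpace ℂ F] [CompleteSpace F]
    (an : H → F →L[ℂ] F) (u v : ℕ → H) (lam : ℕ → ℝ) (ψ : F) : F :=
  ∑' k : ℕ, (lam k : ℂ) • adjoint (an (u k)) (adjoint (an (v k)) ψ)

/-- `ψ` belongs to the `N`-particle sector `⋀^N h` of the Fock space, i.e. `ψ` is an
eigenvector of the number operator `𝒩 = ∑ₖ (c*_{k,↑} c_{k,↑} + c*_{k,↓} c_{k,↓})` with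
eigenvalue `N` (here the `u k` and `v k` jointly form an orthonormal basis of `h`). -/
def InSector {H F : Type*} [NormedAddCommGroup F] [InnerProductSpace ℂ F] [CompleteSpace F]
    (an : H → F →L[ℂ] F) (u v : ℕ → H) (N : ℕ) (ψ : F) : Prop :=
  ∑' k : ℕ, (adjoint (an (u k)) (an (u k) ψ) + adjoint (an (v k)) (an (v k) ψ)) = (N : ℂ) • ψ

/-- `Ω` is the (normalized) vacuum vector: it is annihilated by every `an f`. -/
def IsVacuum {H F : Type*} [NormedAddCommGroup F] [InnerProductSpace ℂ F]
    (an : H → F →L[ℂ] F) (Ω : F) : Prop :=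
  ‖Ω‖ = 1 ∧ ∀ f : H, an f Ω = 0

/-- The trial states `Ψ_M = (B*)^M Ω`. -/
def PsiM {H F : Type*} [NormedAddCommGroup F] [InnerProductSpace ℂ F] [CompleteSpace F]
    (an : H → F →L[ℂ] F) (u v : ℕ → H) (lam : ℕ → ℝ) (Ω : F) : ℕ → F
  | 0 => Ω
  | M + 1 => applyBd an u v lam (PsiM an u v lam Ω M)

/-- `tp` realizes the Hilbert space `T` as the Hilbert tensor product `h ⊗ h`: inner
products of elementary tensors multiply, and elementary tensors span a dense subspace. -/
def IsHilbertTensorProduct {H T : Type*} [NormedAddCommGroup H] [InnerProductSpace ℂ H]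
    [NormedAddCommGroup T] [InnerProductSpace ℂ T]
    (tp : H →ₗ[ℂ] H →ₗ[ℂ] T) : Prop :=
  (∀ x y z w : H, ⟪tp x y, tp z w⟫_ℂ = ⟪x, z⟫_ℂ * ⟪y, w⟫_ℂ) ∧
  (Submodule.span ℂ {t : T | ∃ x y : H, t = tp x y}).topologicalClosure = ⊤

/-- The elementary antisymmetric tensor `x ∧ y = (x ⊗ y - y ⊗ x)/√2`. -/
def wedgeVec {H T : Type*} [NormedAddCommGroup H] [InnerProductSpace ℂ H]
    [NormedAddCommGroup T] [InnerProductSpace ℂ T]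
    (tp : H →ₗ[ℂ] H →ₗ[ℂ] T) (x y : H) : T :=
  (((Real.sqrt 2 : ℝ) : ℂ))⁻¹ • (tp x y - tp y x)

/-- `Φ = ∑ₖ λₖ • (u k) ∧ (v k)` is a canonical form of `Φ ∈ h ∧ h`: the sequences
`(u k)` and `(v k)` are jointly orthonormal and jointly span `h`, `λₖ ≥ 0` and
`∑ₖ λₖ² = 1`. -/
def CanonicalWedgeForm {H T : Type*} [NormedAddCommGroup H] [InnerProductSpace ℂ H]
    [NormedAddCommGroup T] [InnerProductSpace ℂ T]
    (tp : H →ₗ[ℂ] H →ₗ[ℂ] T) (u v : ℕ → H) (lam : ℕ → ℝ) (Φ : T) : Prop :=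
  Orthonormal ℂ (Sum.elim u v) ∧
  (Submodule.span ℂ (Set.range u ∪ Set.range v)).topologicalClosure = ⊤ ∧
  (∀ k, 0 ≤ lam k) ∧ (∑' k : ℕ, lam k ^ 2) = 1 ∧
  Φ = ∑' k : ℕ, (lam k : ℂ) • wedgeVec tp (u k) (v k)

/-- `G` is the two-body operator `γ₂^Ψ` associated with the state `Ψ`, characterized by
`⟪φ₁ ⊗ φ₂, G (ψ₁ ⊗ ψ₂)⟫ = ⟪Ψ, c*(ψ₁) c*(ψ₂) c(φ₂) c(φ₁) Ψ⟫`. -/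
def IsTwoBodyOp {H F T : Type*} [NormedAddCommGroup H] [InnerProductSpace ℂ H]
    [NormedAddCommGroup F] [InnerProductSpace ℂ F] [CompleteSpace F]
    [NormedAddCommGroup T] [InnerProductSpace ℂ T]
    (tp : H →ₗ[ℂ] H →ₗ[ℂ] T) (an : H → F →L[ℂ] F) (Ψ : F) (G : T →L[ℂ] T) : Prop :=
  ∀ p q r s : H,
    ⟪tp p q, G (tp r s)⟫_ℂ = ⟪Ψ, adjoint (an r) (adjoint (an s) (an q (an p Ψ)))⟫_ℂ



/-- Helper: pair operators in the CAR algebra. -/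
structure PairCAR {F : Type*} [NormedAddCommGroup F] [InnerProductSpace ℂ F] [CompleteSpace F]
    (U V : ℕ → F →L[ℂ] F) : Prop where
  uu : ∀ j k, U j * U k = -(U k * U j)
  vv : ∀ j k, V j * V k = -(V k * V j)
  uv : ∀ j k, U j * V k = -(V k * U j)
  uus : ∀ j k, U j * star (U k) = (if j = k then 1 else 0) - star (U k) * U j
  vvs : ∀ j k, V j * star (V k) = (if j = k then 1 else 0) - star (V k) * V j
  uvs : ∀ j k, U j * star (V k) = -(star (V k) * U j)
  vus : ∀ j k, V j * star (U k) = -(star (U k) * V j)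

namespace PairCAR

variable {F : Type*} [NormedAddCommGroup F] [InnerProductSpace ℂ F] [CompleteSpace F]
  {U V : ℕ → F →L[ℂ] F}

theorem suu (h : PairCAR U V) (j k) : star (U j) * star (U k) = -(star (U k) * star (U j)) := by
  rw [← star_mul, ← star_mul, h.uu, star_neg]

theorem svv (h : PairCAR U V) (j k) : star (V j) * star (V k) = -(star (V k) * star (V j)) := by
  rw [← star_mul, ← star_mul, h.vv, star_neg]

theorem suv (h : PairCAR U V) (j k) : star (U j) * star (V k) = -(star (V k) * star (U j)) := by
  rw [← star_mul, ← star_mul, h.uv, star_neg, neg_neg]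

theorem k1 (h : PairCAR U V) (j k) : U j * (star (U k) * star (V k)) =
    (if j = k then star (V k) else 0) + (star (U k) * star (V k)) * U j := by
  have a := h.uus j k
  have b := h.uvs j k
  split_ifs at a ⊢ <;>
    linear_combination (norm := noncomm_ring) a * star (V k) - star (U k) * b

theorem k2 (h : PairCAR U V) (j k) : V j * (star (U k) * star (V k)) =
    -(if j = k then star (U k) else 0) + (star (U k) * star (V k)) * V j := by
  have a := h.vus j k
  have b := h.vvs j k
  split_ifs at b ⊢ <;>
    linear_combination (norm := noncomm_ring) a * star (V k) - star (U k) * b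

theorem k3 (h : PairCAR U V) (j k) : star (V j) * (star (U k) * star (V k)) =
    (star (U k) * star (V k)) * star (V j) := by
  have a := h.svv j k
  have b := h.suv k j
  linear_combination (norm := noncomm_ring) b * star (V k) - star (U k) * a

theorem k3' (h : PairCAR U V) (j k) : star (U j) * (star (U k) * star (V k)) =
    (star (U k) * star (V k)) * star (U j) := by
  have a := h.suu j k
  have b := h.suv j k
  linear_combination (norm := noncomm_ring) a * star (V k) - star (U k) * b

theorem k4 (h : PairCAR U V) (j k) : (V j * U j) * (star (U k) * star (V k)) =
    (star (U k) * star (V k)) * (V j * U j) +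
      (if j = k then 1 - star (U j) * U j - star (V j) * V j else 0) := by
  have a := h.k1 j k
  have b := h.k2 j k
  have c := h.vvs j k
  by_cases e : j = k
  · subst e
    rw [if_pos rfl] at a b c ⊢
    linear_combination (norm := noncomm_ring) V j * a + b * U j + c
  · rw [if_neg e] at a b c ⊢
    linear_combination (norm := noncomm_ring) V j * a + b * U j

theorem k5 (h : PairCAR U V) (j k) : (star (U j) * star (V j)) * (V k * star (V k)) =
    (V k * star (V k)) * (star (U j) * star (V j)) +
      (if j = k then star (U j) * star (V j) else 0) := by
  have b := h.k2 k j
  have c := h.k3 k j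
  by_cases e : k = j
  · subst e
    rw [if_pos rfl] at b ⊢
    linear_combination (norm := noncomm_ring) -b * star (V k) - V k * c
  · rw [if_neg e] at b
    rw [if_neg (Ne.symm e)]
    linear_combination (norm := noncomm_ring) -b * star (V k) - V k * c

theorem nu (h : PairCAR U V) (j) (ψ : F) : ‖U j ψ‖ ^ 2 + ‖star (U j) ψ‖ ^ 2 = ‖ψ‖ ^ 2 := by
  have a := congrArg (fun T : F →L[ℂ] F => RCLike.re ⟪T ψ, ψ⟫_ℂ) (h.uus j j)
  simp only [if_true, mul_apply_eq_comp, _root_.sub_apply,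
    one_apply_eq_self, inner_sub_left, map_sub, star_eq_adjoint] at a
  rw [adjoint_inner_left, ← adjoint_inner_right] at a
  simp only [inner_self_eq_norm_sq, star_eq_adjoint] at a ⊢
  linarith

theorem nv (h : PairCAR U V) (j) (ψ : F) : ‖V j ψ‖ ^ 2 + ‖star (V j) ψ‖ ^ 2 = ‖ψ‖ ^ 2 := by
  have a := congrArg (fun T : F →L[ℂ] F => RCLike.re ⟪T ψ, ψ⟫_ℂ) (h.vvs j j)
  simp only [if_true, mul_apply_eq_comp, _root_.sub_apply,
    one_apply_eq_self, inner_sub_left, map_sub, star_eq_adjoint] at a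
  rw [adjoint_inner_left, ← adjoint_inner_right] at a
  simp only [inner_self_eq_norm_sq, star_eq_adjoint] at a ⊢
  linarith

theorem nu1 (h : PairCAR U V) (j) (ψ : F) : ‖U j ψ‖ ≤ ‖ψ‖ :=
  le_of_sq_le_sq (by nlinarith [h.nu j ψ, sq_nonneg ‖star (U j) ψ‖]) (norm_nonneg _)

theorem nv1 (h : PairCAR U V) (j) (ψ : F) : ‖V j ψ‖ ≤ ‖ψ‖ :=
  le_of_sq_le_sq (by nlinarith [h.nv j ψ, sq_nonneg ‖star (V j) ψ‖]) (norm_nonneg _)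

theorem nsu1 (h : PairCAR U V) (j) (ψ : F) : ‖star (U j) ψ‖ ≤ ‖ψ‖ :=
  le_of_sq_le_sq (by nlinarith [h.nu j ψ, sq_nonneg ‖U j ψ‖]) (norm_nonneg _)

theorem nsv1 (h : PairCAR U V) (j) (ψ : F) : ‖star (V j) ψ‖ ≤ ‖ψ‖ :=
  le_of_sq_le_sq (by nlinarith [h.nv j ψ, sq_nonneg ‖V j ψ‖]) (norm_nonneg _)

theorem finB (h : PairCAR U V) (lam : ℕ → ℝ) (S : Finset ℕ) (ψ : F) :
    ‖∑ k ∈ S, (lam k : ℂ) • (star (U k) * star (V k)) ψ‖ ^ 2 ≤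
      ‖∑ k ∈ S, (lam k : ℂ) • (V k * U k) ψ‖ ^ 2 + (∑ k ∈ S, lam k ^ 2) * ‖ψ‖ ^ 2 := by
  set B : F →L[ℂ] F := ∑ k ∈ S, (lam k : ℂ) • (V k * U k) with hB
  have hs : star B = ∑ k ∈ S, (lam k : ℂ) • (star (U k) * star (V k)) := by
    simp [hB, star_sum, star_smul]
  have e1 : ∑ k ∈ S, (lam k : ℂ) • (star (U k) * star (V k)) ψ = star B ψ := by
    rw [hs]; simp [_root_.sum_apply]
  have e2 : ∑ k ∈ S, (lam k : ℂ) • (V k * U k) ψ = B ψ := by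
    simp [hB, _root_.sum_apply]
  have e3 : B * star B = star B * B +
      ∑ k ∈ S, ((lam k ^ 2 : ℝ) : ℂ) • (1 - star (U k) * U k - star (V k) * V k) := by
    rw [hs, hB, Finset.sum_mul_sum, Finset.sum_mul_sum, Finset.sum_comm, ← Finset.sum_add_distrib]
    refine Finset.sum_congr rfl fun k hk => ?_
    have : ∀ j ∈ S, ((lam j : ℂ) • (V j * U j)) * ((lam k : ℂ) • (star (U k) * star (V k))) =
      ((lam k : ℂ) • (star (U k) * star (V k))) * ((lam j : ℂ) • (V j * U j)) +
       (if j = k then ((lam k ^ 2 : ℝ) : ℂ) • (1 - star (U k) * U k - star (V k) * V k) else 0) := by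
      intro j _
      rw [smul_mul_smul_comm, smul_mul_smul_comm, h.k4, smul_add, mul_comm (lam k : ℂ)]
      congr 1
      split_ifs with e
      · subst e; congr 1; push_cast; ring
      · simp
    rw [Finset.sum_congr rfl this, Finset.sum_add_distrib, Finset.sum_ite_eq' S k]
    simp [hk]
  have e4 : ∀ T : F →L[ℂ] F, RCLike.re ⟪(star T * T) ψ, ψ⟫_ℂ = ‖T ψ‖ ^ 2 := by
    intro T
    rw [mul_apply_eq_comp, star_eq_adjoint, adjoint_inner_left, inner_self_eq_norm_sq]
  have a := congrArg (fun T : F →L[ℂ] F => RCLike.re ⟪T ψ, ψ⟫_ℂ) e3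
  have e5 := e4 (star B)
  rw [star_star] at e5
  simp only [_root_.add_apply, inner_add_left, map_add, e4, e5] at a
  rw [e1, e2, a]
  gcongr
  rw [_root_.sum_apply, sum_inner, map_sum, Finset.sum_mul]
  refine Finset.sum_le_sum fun k _ => ?_
  rw [_root_.smul_apply, inner_smul_left, Complex.conj_ofReal]
  have e6 : RCLike.re ⟪((1 : F →L[ℂ] F) - star (U k) * U k - star (V k) * V k) ψ, ψ⟫_ℂ =
      ‖ψ‖ ^ 2 - ‖U k ψ‖ ^ 2 - ‖V k ψ‖ ^ 2 := by
    simp only [_root_.sub_apply, inner_sub_left, map_sub, e4,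
      one_apply_eq_self, inner_self_eq_norm_sq]
  have e7 : RCLike.re (((lam k ^ 2 : ℝ) : ℂ) *
      ⟪((1 : F →L[ℂ] F) - star (U k) * U k - star (V k) * V k) ψ, ψ⟫_ℂ) =
      lam k ^ 2 * RCLike.re ⟪((1 : F →L[ℂ] F) - star (U k) * U k - star (V k) * V k) ψ, ψ⟫_ℂ :=
    Complex.re_ofReal_mul _ _
  rw [e7, e6]
  have := sq_nonneg ‖U k ψ‖
  have := sq_nonneg ‖V k ψ‖
  exact mul_le_mul_of_nonneg_left (by linarith) (sq_nonneg _)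

theorem summB (h : PairCAR U V) {lam : ℕ → ℝ} (h0 : ∀ k, 0 ≤ lam k)
    (hl : Summable fun k => lam k ^ 2) (h1 : ∑' k, lam k ^ 2 = 1)
    (ψ : F) (C : ℝ) (hC : ∀ k, ‖U k ψ‖ ≤ C * lam k) :
    Summable fun k => (lam k : ℂ) • (star (U k) * star (V k)) ψ := by
  rw [summable_iff_vanishing_norm]
  intro ε hε
  set D := C ^ 2 + ‖ψ‖ ^ 2 + 1 with hD
  have hDp : 0 < D := by positivity
  obtain ⟨s, hs⟩ := (summable_iff_vanishing_norm.mp hl) (ε ^ 2 / D) (by positivity)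
  refine ⟨s, fun t ht => ?_⟩
  have a := hs t ht
  have hn : 0 ≤ ∑ k ∈ t, lam k ^ 2 := Finset.sum_nonneg fun k _ => sq_nonneg _
  rw [Real.norm_of_nonneg hn, lt_div_iff₀ hDp] at a
  have hle : ∑ k ∈ t, lam k ^ 2 ≤ 1 := by
    rw [← h1]; exact hl.sum_le_tsum t fun k _ => sq_nonneg _
  have b := h.finB lam t ψ
  have c : ‖∑ k ∈ t, (lam k : ℂ) • (V k * U k) ψ‖ ≤ C * ∑ k ∈ t, lam k ^ 2 := by
    refine (norm_sum_le _ _).trans ?_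
    rw [Finset.mul_sum]
    refine Finset.sum_le_sum fun k _ => ?_
    rw [norm_smul, Complex.norm_real, Real.norm_of_nonneg (h0 k)]
    have := (h.nv1 k (U k ψ)).trans (hC k)
    have := mul_le_mul_of_nonneg_left this (h0 k)
    calc _ ≤ _ := this
      _ = _ := by ring
  have d : ‖∑ k ∈ t, (lam k : ℂ) • (V k * U k) ψ‖ ^ 2 ≤ C ^ 2 * ∑ k ∈ t, lam k ^ 2 := by
    calc _ ≤ (C * ∑ k ∈ t, lam k ^ 2) ^ 2 := by gcongr
      _ = C ^ 2 * ((∑ k ∈ t, lam k ^ 2) * (∑ k ∈ t, lam k ^ 2)) := by ring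
      _ ≤ C ^ 2 * ((∑ k ∈ t, lam k ^ 2) * 1) := by gcongr
      _ = _ := by ring
  refine lt_of_pow_lt_pow_left₀ 2 hε.le ?_
  nlinarith

/-- Main structural induction. -/
theorem main (h : PairCAR U V) {lam : ℕ → ℝ} (h0 : ∀ k, 0 ≤ lam k)
    (hl : Summable fun k => lam k ^ 2) (h1 : ∑' k, lam k ^ 2 = 1)
    (Ψ : ℕ → F) (hu : ∀ k, U k (Ψ 0) = 0) (hv : ∀ k, V k (Ψ 0) = 0)
    (hΨ : ∀ m, Ψ (m + 1) = ∑' k, (lam k : ℂ) • (star (U k) * star (V k)) (Ψ m)) (m : ℕ) :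
    HasSum (fun k => (lam k : ℂ) • (star (U k) * star (V k)) (Ψ m)) (Ψ (m + 1)) ∧
    (∀ j, U j (Ψ (m + 1)) = (((m + 1 : ℕ) : ℂ) * lam j) • star (V j) (Ψ m)) ∧
    (∀ j, V j (Ψ (m + 1)) = -((((m + 1 : ℕ) : ℂ) * lam j) • star (U j) (Ψ m))) := by
  have key : ∀ m, (∃ C : ℝ, ∀ k, ‖U k (Ψ m)‖ ≤ C * lam k) →
      (∀ j, HasSum (fun k => (lam k : ℂ) • (star (U k) * star (V k)) (U j (Ψ m)))
        (((m : ℂ) * lam j) • star (V j) (Ψ m))) →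
      (∀ j, HasSum (fun k => (lam k : ℂ) • (star (U k) * star (V k)) (V j (Ψ m)))
        (-(((m : ℂ) * lam j) • star (U j) (Ψ m)))) →
      HasSum (fun k => (lam k : ℂ) • (star (U k) * star (V k)) (Ψ m)) (Ψ (m + 1)) ∧
    (∀ j, U j (Ψ (m + 1)) = (((m + 1 : ℕ) : ℂ) * lam j) • star (V j) (Ψ m)) ∧
    (∀ j, V j (Ψ (m + 1)) = -((((m + 1 : ℕ) : ℂ) * lam j) • star (U j) (Ψ m))) := by
    rintro m ⟨C, hC⟩ hU hV
    have hS : HasSum (fun k => (lam k : ℂ) • (star (U k) * star (V k)) (Ψ m)) (Ψ (m + 1)) := by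
      rw [hΨ]; exact (h.summB h0 hl h1 _ C hC).hasSum
    refine ⟨hS, fun j => ?_, fun j => ?_⟩
    · have a := hS.mapL (U j)
      have b := (hasSum_ite_eq j ((lam j : ℂ) • star (V j) (Ψ m))).add (hU j)
      refine (a.unique (HasSum.congr_fun b ?_)).trans ?_
      · intro k
        have := congrArg (fun T : F →L[ℂ] F => T (Ψ m)) (h.k1 j k)
        simp only [mul_apply_eq_comp, _root_.add_apply] at this ⊢
        rw [map_smul, this, smul_add]
        congr 1
        by_cases e : j = k
        · subst e; simp
        · simp [e, Ne.symm e]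
      · rw [← add_smul]; congr 1; push_cast; ring
    · have a := hS.mapL (V j)
      have b := (hasSum_ite_eq j (-((lam j : ℂ) • star (U j) (Ψ m)))).add (hV j)
      refine (a.unique (HasSum.congr_fun b ?_)).trans ?_
      · intro k
        have := congrArg (fun T : F →L[ℂ] F => T (Ψ m)) (h.k2 j k)
        simp only [mul_apply_eq_comp, _root_.add_apply] at this ⊢
        rw [map_smul, this, smul_add]
        congr 1
        by_cases e : j = k
        · subst e; simp
        · simp [e, Ne.symm e]
      · rw [← neg_add, ← add_smul]; congr 2; push_cast; ring
  induction m with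
  | zero =>
    refine key 0 ⟨0, fun k => by simp [hu]⟩ (fun j => ?_) (fun j => ?_)
    · simpa [hu] using (hasSum_zero : HasSum (fun _ : ℕ => (0 : F)) 0)
    · simpa [hv] using (hasSum_zero : HasSum (fun _ : ℕ => (0 : F)) 0)
  | succ m ih =>
    obtain ⟨hS, hU, hV⟩ := ih
    refine key (m + 1) ⟨(m + 1) * ‖Ψ m‖, fun k => ?_⟩ (fun j => ?_) (fun j => ?_)
    · rw [hU, norm_smul, norm_mul, Complex.norm_real, Real.norm_of_nonneg (h0 k),
        Complex.norm_natCast]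
      have := h.nsv1 k (Ψ m)
      have h3 := h0 k
      calc _ ≤ (((m + 1 : ℕ) : ℝ) * lam k) * ‖Ψ m‖ := by gcongr
        _ = _ := by push_cast; ring
    · refine ((hS.mapL (star (V j))).const_smul (((m + 1 : ℕ) : ℂ) * lam j)).congr_fun ?_
      intro k
      have := congrArg (fun T : F →L[ℂ] F => T (Ψ m)) (h.k3 j k)
      simp only [mul_apply_eq_comp] at this ⊢
      rw [hU, map_smul, map_smul, map_smul, this, smul_comm]
    · refine ((hS.mapL (star (U j))).const_smul (((m + 1 : ℕ) : ℂ) * lam j)).neg.congr_fun ?_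
      intro k
      have := congrArg (fun T : F →L[ℂ] F => T (Ψ m)) (h.k3' j k)
      simp only [mul_apply_eq_comp] at this ⊢
      rw [hV, map_neg, map_neg, map_smul, map_smul, map_smul, this, smul_comm, smul_neg]



theorem normEq (h : PairCAR U V) {lam : ℕ → ℝ} (Ψ : ℕ → F)
    (hu : ∀ k, U k (Ψ 0) = 0) (hv : ∀ k, V k (Ψ 0) = 0)
    (hU : ∀ m j, U j (Ψ (m + 1)) = (((m + 1 : ℕ) : ℂ) * lam j) • star (V j) (Ψ m))
    (hV : ∀ m j, V j (Ψ (m + 1)) = -((((m + 1 : ℕ) : ℂ) * lam j) • star (U j) (Ψ m)))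
    (j m : ℕ) : ‖U j (Ψ m)‖ ^ 2 = ‖V j (Ψ m)‖ ^ 2 := by
  induction m with
  | zero => rw [hu, hv]
  | succ m ih =>
    have a := h.nu j (Ψ m)
    have b := h.nv j (Ψ m)
    rw [hU, hV, norm_neg, norm_smul, norm_smul, mul_pow, mul_pow]
    congr 1
    linarith

theorem final (h : PairCAR U V) {lam : ℕ → ℝ} (h0 : ∀ k, 0 ≤ lam k)
    (hl : Summable fun k => lam k ^ 2) (h1 : ∑' k, lam k ^ 2 = 1)
    (Ψ : ℕ → F) (hu : ∀ k, U k (Ψ 0) = 0) (hv : ∀ k, V k (Ψ 0) = 0)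
    (hΨ : ∀ m, Ψ (m + 1) = ∑' k, (lam k : ℂ) • (star (U k) * star (V k)) (Ψ m)) (m : ℕ) :
    ⟪Ψ m, ∑' k, (lam k : ℂ) • (star (U k) * star (V k))
        (∑' k, (lam k : ℂ) • (V k * U k) (Ψ m))⟫_ℂ =
      (((m : ℝ) * ‖Ψ m‖ ^ 2 - ((m : ℝ) - 1) / 2 *
          ∑' k : ℕ, lam k ^ 2 * (‖U k (Ψ m)‖ ^ 2 + ‖V k (Ψ m)‖ ^ 2) : ℝ) : ℂ) := by
  have hm := h.main h0 hl h1 Ψ hu hv hΨ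
  cases m with
  | zero => simp [hu, hv]
  | succ m =>
  obtain ⟨hS, hU, hV⟩ := hm m
  have hop : ∀ T : ℕ → F →L[ℂ] F, (∀ k ψ, ‖T k ψ‖ ≤ ‖ψ‖) →
      ∃ A : F →L[ℂ] F, HasSum (fun k => ((lam k ^ 2 : ℝ) : ℂ) • T k) A := by
    intro T hT
    refine ⟨_, (Summable.of_norm_bounded hl fun k => ?_).hasSum⟩
    rw [norm_smul, Complex.norm_real, Real.norm_of_nonneg (sq_nonneg _)]
    have : ‖T k‖ ≤ 1 := ContinuousLinearMap.opNorm_le_bound _ zero_le_one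
      (fun x => by rw [one_mul]; exact hT k x)
    exact mul_le_of_le_one_right (sq_nonneg _) this
  obtain ⟨A, hA⟩ := hop (fun k => V k * star (V k))
    (fun k ψ => (h.nv1 k _).trans (h.nsv1 k ψ))
  obtain ⟨N, hN⟩ := hop (fun k => star (U k) * U k)
    (fun k ψ => (h.nsu1 k _).trans (h.nu1 k ψ))
  have hAψ : ∀ ψ : F, HasSum (fun k => ((lam k ^ 2 : ℝ) : ℂ) • (V k) (star (V k) ψ)) (A ψ) :=
    fun ψ => hA.mapL (ContinuousLinearMap.apply ℂ F ψ)
  have hNψ : ∀ ψ : F, HasSum (fun k => ((lam k ^ 2 : ℝ) : ℂ) • star (U k) (U k ψ)) (N ψ) :=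
    fun ψ => hN.mapL (ContinuousLinearMap.apply ℂ F ψ)
  have hcomm : ∀ j, (star (U j) * star (V j)) * A = A * (star (U j) * star (V j)) +
      ((lam j ^ 2 : ℝ) : ℂ) • (star (U j) * star (V j)) := by
    intro j
    refine (hA.mul_left (star (U j) * star (V j))).unique (HasSum.congr_fun
      ((hA.mul_right (star (U j) * star (V j))).add
        (hasSum_ite_eq j (((lam j ^ 2 : ℝ) : ℂ) • (star (U j) * star (V j))))) ?_)
    intro k
    rw [mul_smul_comm, h.k5, smul_add, smul_mul_assoc]
    congr 1
    by_cases e : j = k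
    · subst e; simp
    · simp [e, Ne.symm e]
  have hB : HasSum (fun k => (lam k : ℂ) • (V k * U k) (Ψ (m + 1)))
      (((m + 1 : ℕ) : ℂ) • A (Ψ m)) := by
    refine HasSum.congr_fun ((hAψ (Ψ m)).const_smul ((m + 1 : ℕ) : ℂ)) ?_
    intro k
    simp only [mul_apply_eq_comp]
    rw [hU, map_smul, smul_smul, smul_smul]
    congr 1
    push_cast; ring
  have hBd : HasSum (fun k => (lam k : ℂ) • (star (U k) * star (V k))
      (((m + 1 : ℕ) : ℂ) • A (Ψ m)))
      (((m + 1 : ℕ) : ℂ) • A (Ψ (m + 1)) + N (Ψ (m + 1))) := by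
    refine HasSum.congr_fun (((hS.mapL A).const_smul ((m + 1 : ℕ) : ℂ)).add (hNψ (Ψ (m + 1)))) ?_
    intro k
    have := congrArg (fun T : F →L[ℂ] F => T (Ψ m)) (hcomm k)
    simp only [mul_apply_eq_comp, _root_.add_apply, _root_.smul_apply] at this ⊢
    rw [hU]
    simp only [map_smul, this, smul_add, smul_smul]
    congr 2
    · ring
    · push_cast; ring
  rw [hB.tsum_eq, hBd.tsum_eq, inner_add_right, inner_smul_right]
  set ψ := Ψ (m + 1) with hψ
  have hs : Summable fun k => lam k ^ 2 * ‖U k ψ‖ ^ 2 := by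
    refine Summable.of_nonneg_of_le (fun k => by positivity) (fun k => ?_) (hl.mul_right (‖ψ‖ ^ 2))
    have := h.nu1 k ψ
    gcongr
  have hne : ∀ k, ‖U k ψ‖ ^ 2 = ‖V k ψ‖ ^ 2 := fun k =>
    h.normEq Ψ hu hv (fun m => (hm m).2.1) (fun m => (hm m).2.2) k (m + 1)
  set s := ∑' k, lam k ^ 2 * ‖U k ψ‖ ^ 2 with hsd
  have e1 : ⟪ψ, N ψ⟫_ℂ = (s : ℂ) := by
    refine ((hNψ ψ).mapL (innerSL ℂ ψ)).unique (HasSum.congr_fun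
      (Complex.hasSum_ofReal.mpr hs.hasSum) fun k => ?_)
    simp only [innerSL_apply_apply]
    rw [inner_smul_right, star_eq_adjoint, adjoint_inner_right, inner_self_eq_norm_sq_to_K]
    push_cast; rfl
  have e2 : ⟪ψ, A ψ⟫_ℂ = ((‖ψ‖ ^ 2 - s : ℝ) : ℂ) := by
    have hl1 : HasSum (fun k => lam k ^ 2) 1 := h1 ▸ hl.hasSum
    have hr : HasSum (fun k => lam k ^ 2 * ‖ψ‖ ^ 2 - lam k ^ 2 * ‖U k ψ‖ ^ 2) (‖ψ‖ ^ 2 - s) := by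
      simpa using (hl1.mul_right (‖ψ‖ ^ 2)).sub hs.hasSum
    refine ((hAψ ψ).mapL (innerSL ℂ ψ)).unique (HasSum.congr_fun
      (Complex.hasSum_ofReal.mpr hr) fun k => ?_)
    simp only [innerSL_apply_apply]
    have e : ⟪ψ, V k (star (V k) ψ)⟫_ℂ = ((‖star (V k) ψ‖ ^ 2 : ℝ) : ℂ) := by
      rw [star_eq_adjoint, ← adjoint_inner_left, inner_self_eq_norm_sq_to_K]
      push_cast; rfl
    rw [inner_smul_right, e, hne, ← h.nv k ψ]
    push_cast; ring
  have e3 : ∑' k : ℕ, lam k ^ 2 * (‖U k ψ‖ ^ 2 + ‖V k ψ‖ ^ 2) = 2 * s := by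
    rw [hsd, ← tsum_mul_left]
    refine tsum_congr fun k => ?_
    rw [← hne]; ring
  rw [e1, e2, e3]
  push_cast; ring

end PairCAR

/-- **Equation (28).** For every `M ∈ ℕ`:
`⟪Ψ_M, B*B Ψ_M⟫ = M‖Ψ_M‖² - (M-1)/2 · ∑ₖ λₖ²(‖c_{k,↑}Ψ_M‖² + ‖c_{k,↓}Ψ_M‖²)`. -/
theorem PsiM_BdB_identity
    {H F T : Type*} [NormedAddCommGroup H] [InnerProductSpace ℂ H] [CompleteSpace H]
    [NormedAddCommGroup F] [InnerProductSpace ℂ F] [CompleteSpace F]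
    [NormedAddCommGroup T] [InnerProductSpace ℂ T] [CompleteSpace T]
    (an : H → F →L[ℂ] F) (hCAR : SatisfiesCAR an)
    (tp : H →ₗ[ℂ] H →ₗ[ℂ] T) (htp : IsHilbertTensorProduct tp)
    (u v : ℕ → H) (lam : ℕ → ℝ) (Φ : T) (hΦnorm : ‖Φ‖ = 1)
    (hΦ : CanonicalWedgeForm tp u v lam Φ)
    (Ω : F) (hΩ : IsVacuum an Ω) :
    ∀ M : ℕ,
      ⟪PsiM an u v lam Ω M,
          applyBd an u v lam (applyB an u v lam (PsiM an u v lam Ω M))⟫_ℂ =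
        (((M : ℝ) * ‖PsiM an u v lam Ω M‖ ^ 2 - ((M : ℝ) - 1) / 2 *
          ∑' k : ℕ, lam k ^ 2 * (‖an (u k) (PsiM an u v lam Ω M)‖ ^ 2
            + ‖an (v k) (PsiM an u v lam Ω M)‖ ^ 2) : ℝ) : ℂ) := by
  intro M
  obtain ⟨hon, -, h0, h1, -⟩ := hΦ
  have hl : Summable fun k => lam k ^ 2 := by
    by_contra hc
    rw [tsum_eq_zero_of_not_summable hc] at h1
    exact zero_ne_one h1
  have hin := orthonormal_iff_ite.mp hon
  have c1 : ∀ f g, an f * an g = -(an g * an f) := fun f g => eq_neg_of_add_eq_zero_left (hCAR.1 f g)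
  have c2 : ∀ f g, an f * star (an g) = ⟪f, g⟫_ℂ • (1 : F →L[ℂ] F) - star (an g) * an f :=
    fun f g => eq_sub_of_add_eq (hCAR.2 f g)
  have huu : ∀ j k, ⟪u j, u k⟫_ℂ = if j = k then 1 else 0 := fun j k => by
    simpa using hin (Sum.inl j) (Sum.inl k)
  have hvv : ∀ j k, ⟪v j, v k⟫_ℂ = if j = k then 1 else 0 := fun j k => by
    simpa using hin (Sum.inr j) (Sum.inr k)
  have huv : ∀ j k, ⟪u j, v k⟫_ℂ = 0 := fun j k => by
    simpa using hin (Sum.inl j) (Sum.inr k)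
  have hvu : ∀ j k, ⟪v j, u k⟫_ℂ = 0 := fun j k => by
    simpa using hin (Sum.inr j) (Sum.inl k)
  have hp : PairCAR (fun k => an (u k)) (fun k => an (v k)) :=
    { uu := fun j k => c1 _ _
      vv := fun j k => c1 _ _
      uv := fun j k => c1 _ _
      uus := fun j k => by rw [c2, huu]; split_ifs <;> simp
      vvs := fun j k => by rw [c2, hvv]; split_ifs <;> simp
      uvs := fun j k => by rw [c2, huv]; simp
      vus := fun j k => by rw [c2, hvu]; simp }
  exact hp.final h0 hl h1 (PsiM an u v lam Ω) (fun k => hΩ.2 _) (fun k => hΩ.2 _)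
    (fun m => rfl) M
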